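/- arXiv:2008.04892 — 2 statements merged into one kernel-verified Lean document; each statement's English description precedes it below -/
import Mathlib

section
/- Let K be an n×n complex matrix and let F be an n×m complex matrix that is a maximal robust K-frame. Then for every invertible n×n complex matrix A and every unitary diagonal m×m complex matrix D, the matrix AFD is a maximal robust (AK)-frame: for every σ ⊆ I_m with |σ| = rank(AK) (= rank K), the columns of AFD indexed by σ are linearly independent and their span contains the column space of AK. -/
open Matrix

/-- A matrix `F` is a `K`-frame when the column space of `K` is contained in the
column space of `F`. -/
def Matrix.IsKFrame {n m : ℕ} (K : Matrix (Fin n) (Fin n) ℂ)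
    (F : Matrix (Fin n) (Fin m) ℂ) : Prop :=
  Set.range K.mulVec ⊆ Set.range F.mulVec

/-- `F` is a maximal robust `K`-frame: every `rank K` of its columns are linearly
independent and span a subspace containing the column space of `K`
(i.e. they form an exact `K`-frame). -/
def Matrix.IsMaximalRobust {n m : ℕ} (K : Matrix (Fin n) (Fin n) ℂ)
    (F : Matrix (Fin n) (Fin m) ℂ) : Prop :=
  ∀ σ : Finset (Fin m), σ.card = K.rank →
    LinearIndependent ℂ (fun i : σ => fun r : Fin n => F r (i : Fin m)) ∧
    Set.range K.mulVec ⊆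
      (Submodule.span ℂ (Set.range fun i : σ => fun r : Fin n => F r (i : Fin m)) :
        Set (Fin n → ℂ))

theorem Matrix.column_mul_diagonal {l n m : Type*} [Fintype n] [Fintype m] [DecidableEq m]
    {R : Type*} [CommSemiring R] (A : Matrix l n R) (F : Matrix n m R) (d : m → R) (i : m) :
    (fun r => (A * F * diagonal d) r i) = d i • A *ᵥ fun r => F r i := by
  ext r
  rw [mul_diagonal, mul_comm]
  rfl

/-- if `F` is a maximal robust `K`-frame, `A` is invertible and `D` is a
unitary diagonal matrix, then `AFD` is a maximal robust `(AK)`-frame. -/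
theorem stmt13 {n m : ℕ} (K : Matrix (Fin n) (Fin n) ℂ) (F : Matrix (Fin n) (Fin m) ℂ)
    (hKF : K.IsKFrame F) (hMR : K.IsMaximalRobust F)
    (A : Matrix (Fin n) (Fin n) ℂ) (hA : IsUnit A)
    (d : Fin m → ℂ) (hd : ∀ i, ‖d i‖ = 1) :
    (A * K).IsKFrame (A * F * Matrix.diagonal d) ∧
      (A * K).IsMaximalRobust (A * F * Matrix.diagonal d) := by
  have hd0 (i : Fin m) : d i ≠ 0 := by
    rw [← norm_ne_zero_iff, hd i]
    exact one_ne_zero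
  refine ⟨?_, fun σ hσ => ?_⟩
  · rintro _ ⟨x, rfl⟩
    obtain ⟨y, hy⟩ := hKF ⟨x, rfl⟩
    refine ⟨fun i => (d i)⁻¹ * y i, ?_⟩
    have hdy : diagonal d *ᵥ (fun i => (d i)⁻¹ * y i) = y := by
      ext i
      simp [mulVec_diagonal, hd0 i]
    rw [← mulVec_mulVec, hdy, ← mulVec_mulVec, hy, mulVec_mulVec]
  · rw [rank_mul_eq_right_of_isUnit_det A K ((isUnit_iff_isUnit_det A).1 hA)] at hσ
    obtain ⟨hli, hspan⟩ := hMR σ hσ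
    have hcol : (fun i : σ => fun r : Fin n => (A * F * diagonal d) r (i : Fin m)) =
        fun i : σ => d i • A *ᵥ fun r => F r i :=
      funext fun i => column_mul_diagonal A F d i
    rw [hcol]
    constructor
    · have hAli := hli.map' A.mulVecLin
        (LinearMap.ker_eq_bot.2 (mulVec_injective_iff_isUnit.2 hA))
      exact hAli.units_smul fun i : σ => Units.mk0 (d i) (hd0 i)
    · rintro _ ⟨x, rfl⟩
      have hx := Submodule.mem_map_of_mem (f := A.mulVecLin) (hspan ⟨x, rfl⟩)
      rw [Submodule.map_span, mulVecLin_apply, mulVec_mulVec] at hx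
      refine Submodule.span_le.2 ?_ hx
      rintro _ ⟨_, ⟨i, rfl⟩, rfl⟩
      rw [SetLike.mem_coe, ← Submodule.smul_mem_iff _ (hd0 i)]
      exact Submodule.subset_span ⟨i, rfl⟩
end

section
/- Let K be an n×n complex matrix and let F be an n×m complex matrix whose columns form a K-frame satisfying the minimal redundancy condition for r-erasures. Then for every n×n complex matrix A and every unitary diagonal m×m complex matrix D, the matrix AFD satisfies the minimal redundancy condition for r-erasures as an (AK)-frame: for every σ ⊆ I_m with |σ| = r, the column space of AK is contained in the span of the columns of AFD with indices outside σ. -/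
open Matrix

/-- `F` satisfies the minimal redundancy condition for `r`-erasures (as a `K`-frame):
for every `σ` of cardinality `r`, the column space of `K` is contained in the span of
the columns of `F` outside `σ`. -/
def Matrix.MRCForErasures {n m : ℕ} (K : Matrix (Fin n) (Fin n) ℂ)
    (F : Matrix (Fin n) (Fin m) ℂ) (r : ℕ) : Prop :=
  ∀ σ : Finset (Fin m), σ.card = r →
    Set.range K.mulVec ⊆
      (Submodule.span ℂ ((fun j => fun i : Fin n => F i j) '' {j | j ∉ σ}) :
        Set (Fin n → ℂ))

/-- if `F` is a `K`-frame satisfying the minimal redundancy condition for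
`r`-erasures, then for every square matrix `A` and unitary diagonal `D`, the matrix
`AFD` satisfies the minimal redundancy condition for `r`-erasures as an `(AK)`-frame. -/
theorem stmt14 {n m : ℕ} (K : Matrix (Fin n) (Fin n) ℂ) (F : Matrix (Fin n) (Fin m) ℂ)
    (hKF : K.IsKFrame F) (r : ℕ) (hMRC : K.MRCForErasures F r)
    (A : Matrix (Fin n) (Fin n) ℂ)
    (d : Fin m → ℂ) (hd : ∀ i, ‖d i‖ = 1) :
    (A * K).MRCForErasures (A * F * Matrix.diagonal d) r := by
  intro σ hσ
  rintro _ ⟨x, rfl⟩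
  have hx : K *ᵥ x ∈ Submodule.span ℂ ((fun j => fun i : Fin n => F i j) '' {j | j ∉ σ}) :=
    hMRC σ hσ ⟨x, rfl⟩
  have hAx := Submodule.mem_map_of_mem (f := A.mulVecLin) hx
  rw [Submodule.map_span] at hAx
  rw [← Matrix.mulVec_mulVec, SetLike.mem_coe]
  refine Submodule.span_le.2 ?_ hAx
  rintro _ ⟨_, ⟨j, hj, rfl⟩, rfl⟩
  have hdj : d j ≠ 0 := norm_ne_zero_iff.1 (by simp [hd j])
  have hcol : A.mulVecLin (fun i => F i j) =
      (d j)⁻¹ • fun i => (A * F * Matrix.diagonal d) i j := by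
    ext i
    rw [Pi.smul_apply, Matrix.mul_diagonal, smul_eq_mul, mul_comm _ (d j),
      inv_mul_cancel_left₀ hdj]
    rfl
  rw [SetLike.mem_coe, hcol]
  exact Submodule.smul_mem _ _ (Submodule.subset_span ⟨j, hj, rfl⟩)
end
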